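/- Let e₁ = (1/2)·!![1,1,1,1; 1,1,-1,-1; 1,-1,1,-1; 1,-1,-1,1], e₂ = diag(1,1,1,-1), e₃ = !![1,0,0,0; 0,1,0,0; 0,0,0,1; 0,0,1,0], e₄ = !![1,0,0,0; 0,0,1,0; 0,1,0,0; 0,0,0,1] be 4×4 real matrices. Then the subgroup of GL(4,ℝ) generated by e₁, e₂, e₃, e₄ is finite of order 1152 = 2⁷·3². -/

import Mathlib

open Matrix

namespace WeylF4

/-- The short roots of `F₄`, scaled by two. -/
def shortRoots : Finset (Fin 4 → ℤ) :=
  {![2, 0, 0, 0], ![0, 2, 0, 0], ![0, 0, 2, 0], ![0, 0, 0, 2],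
   ![-2, 0, 0, 0], ![0, -2, 0, 0], ![0, 0, -2, 0], ![0, 0, 0, -2],
   ![1, 1, 1, 1], ![1, 1, 1, -1], ![1, 1, -1, 1], ![1, 1, -1, -1],
   ![1, -1, 1, 1], ![1, -1, 1, -1], ![1, -1, -1, 1], ![1, -1, -1, -1],
   ![-1, 1, 1, 1], ![-1, 1, 1, -1], ![-1, 1, -1, 1], ![-1, 1, -1, -1],
   ![-1, -1, 1, 1], ![-1, -1, 1, -1], ![-1, -1, -1, 1], ![-1, -1, -1, -1]}

theorem mem_shortRoots {v : Fin 4 → ℤ} : v ∈ shortRoots ↔ v ⬝ᵥ v = 4 := by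
  constructor
  · have : ∀ v ∈ shortRoots, v ⬝ᵥ v = 4 := by decide +kernel
    exact this v
  · intro h
    have key : ∀ a ∈ Finset.Icc (-2 : ℤ) 2, ∀ b ∈ Finset.Icc (-2 : ℤ) 2,
        ∀ c ∈ Finset.Icc (-2 : ℤ) 2, ∀ d ∈ Finset.Icc (-2 : ℤ) 2,
        a * a + b * b + c * c + d * d = 4 → ![a, b, c, d] ∈ shortRoots := by
      decide +kernel
    simp only [dotProduct, Fin.sum_univ_four] at h
    have bound : ∀ x : ℤ, x * x ≤ 4 → x ∈ Finset.Icc (-2 : ℤ) 2 := fun x hx => by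
      rw [Finset.mem_Icc]
      constructor <;> nlinarith
    have h0 := mul_self_nonneg (v 0)
    have h1 := mul_self_nonneg (v 1)
    have h2 := mul_self_nonneg (v 2)
    have h3 := mul_self_nonneg (v 3)
    have := key (v 0) (bound _ (by linarith)) (v 1) (bound _ (by linarith))
      (v 2) (bound _ (by linarith)) (v 3) (bound _ (by linarith)) h
    rwa [show v = ![v 0, v 1, v 2, v 3] from List.ofFn_inj.mp rfl]

/-- The short roots orthogonal to all vectors of a list. The dot product is written out to make
evaluation by the kernel fast. -/
def orthogonalRoots (l : List (Fin 4 → ℤ)) : Finset (Fin 4 → ℤ) :=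
  shortRoots.filter fun v => ∀ w ∈ l, w 0 * v 0 + w 1 * v 1 + w 2 * v 2 + w 3 * v 3 = 0

theorem mem_orthogonalRoots {l : List (Fin 4 → ℤ)} {v : Fin 4 → ℤ} :
    v ∈ orthogonalRoots l ↔ v ⬝ᵥ v = 4 ∧ ∀ w ∈ l, w ⬝ᵥ v = 0 := by
  rw [orthogonalRoots, Finset.mem_filter, mem_shortRoots]
  simp only [dotProduct, Fin.sum_univ_four]

theorem card_orthogonalRoots_one : ∀ a ∈ shortRoots, (orthogonalRoots [a]).card = 6 := by
  decide +kernel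

theorem card_orthogonalRoots_two :
    ∀ a ∈ shortRoots, ∀ b ∈ orthogonalRoots [a], (orthogonalRoots [a, b]).card = 4 := by
  decide +kernel

theorem card_orthogonalRoots_three :
    ∀ a ∈ shortRoots, ∀ b ∈ orthogonalRoots [a], ∀ c ∈ orthogonalRoots [a, b],
      (orthogonalRoots [a, b, c]).card = 2 := by
  decide +kernel

/-- The integer matrices whose rows are pairwise orthogonal short roots. -/
def frames : Finset (Matrix (Fin 4) (Fin 4) ℤ) :=
  (shortRoots.sigma fun a => (orthogonalRoots [a]).sigma fun b =>
    (orthogonalRoots [a, b]).sigma fun c => orthogonalRoots [a, b, c]).image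
    fun p => of ![p.1, p.2.1, p.2.2.1, p.2.2.2]

theorem card_frames : frames.card = 1152 := by
  rw [frames, Finset.card_image_of_injective, Finset.card_sigma,
    Finset.sum_congr rfl (g := fun _ => 48), Finset.sum_const]
  · decide +kernel
  · intro a ha
    rw [Finset.card_sigma, Finset.sum_congr rfl (g := fun _ => 8), Finset.sum_const,
      card_orthogonalRoots_one a ha, smul_eq_mul]
    intro b hb
    rw [Finset.card_sigma, Finset.sum_congr rfl (card_orthogonalRoots_three a ha b hb),
      Finset.sum_const, card_orthogonalRoots_two a ha b hb, smul_eq_mul]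
  · rintro ⟨a, b, c, d⟩ ⟨a', b', c', d'⟩ h
    have h0 : a = a' := congrFun h 0
    have h1 : b = b' := congrFun h 1
    have h2 : c = c' := congrFun h 2
    have h3 : d = d' := congrFun h 3
    subst h0 h1 h2 h3
    rfl

theorem mem_frames {M : Matrix (Fin 4) (Fin 4) ℤ} : M ∈ frames ↔ M * Mᵀ = 4 := by
  have entries : M * Mᵀ = 4 ↔ ∀ i j, M i ⬝ᵥ M j = if i = j then 4 else 0 := by
    rw [← Matrix.ext_iff]
    refine forall₂_congr fun i j => ?_
    rw [mul_apply', show (4 : Matrix (Fin 4) (Fin 4) ℤ) = diagonal (fun _ => 4) from rfl,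
      diagonal_apply]
    rfl
  rw [entries]
  simp only [frames, Finset.mem_image, Finset.mem_sigma, Sigma.exists, mem_orthogonalRoots,
    mem_shortRoots, List.forall_mem_cons, List.not_mem_nil, false_implies,
    implies_true, and_true]
  constructor
  · rintro ⟨a, b, c, d, h, rfl⟩ i j
    change ![a, b, c, d] i ⬝ᵥ ![a, b, c, d] j = _
    fin_cases i <;> fin_cases j <;> simp [h, dotProduct_comm b a, dotProduct_comm c a,
      dotProduct_comm d a, dotProduct_comm c b, dotProduct_comm d b, dotProduct_comm d c]
  · intro h
    refine ⟨M 0, M 1, M 2, M 3, by simp [h], ?_⟩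
    ext i
    fin_cases i <;> rfl

/-- The simple roots of `F₄`, scaled to be integer vectors. -/
def simpleRoot : Fin 4 → Fin 4 → ℤ :=
  ![![1, -1, -1, -1], ![0, 1, -1, 0], ![0, 0, 1, -1], ![0, 0, 0, 2]]

/-- The reflection in the `i`-th simple root; its values on short roots are exact. -/
def reflect (i : Fin 4) (v : Fin 4 → ℤ) : Fin 4 → ℤ :=
  v - (2 * (v ⬝ᵥ simpleRoot i) / (simpleRoot i ⬝ᵥ simpleRoot i)) • simpleRoot i

/-- Reflect in the `i`-th simple root if that moves `v` towards the dominant chamber. -/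
def ascend (v : Fin 4 → ℤ) (i : Fin 4) : Fin 4 → ℤ :=
  if v ⬝ᵥ simpleRoot i < 0 then reflect i v else v

theorem reflect_mem : ∀ v ∈ shortRoots, ∀ i, reflect i v ∈ shortRoots := by
  decide +kernel

theorem ediv_dotProduct_self_mul : ∀ v ∈ shortRoots, ∀ i,
    2 * (v ⬝ᵥ simpleRoot i) / (simpleRoot i ⬝ᵥ simpleRoot i) *
      (simpleRoot i ⬝ᵥ simpleRoot i) = 2 * (v ⬝ᵥ simpleRoot i) := by
  decide +kernel

/-- A word for the longest element of the subgroup generated by the simple reflections with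
index at least `k`. -/
def longWord (k : Fin 4) : List (Fin 4) :=
  (List.replicate 6 ((List.finRange 4).filter (k ≤ ·))).flatten

theorem foldl_ascend_longWord : ∀ k, ∀ v ∈ shortRoots, (∀ j < k, v j = 0) →
    (longWord k).foldl ascend v = Pi.single k 2 := by
  decide +kernel

/-- The matrices of the simple reflections. -/
noncomputable def gen : Fin 4 → Matrix (Fin 4) (Fin 4) ℝ :=
  ![(1/2 : ℝ) • !![1,1,1,1; 1,1,-1,-1; 1,-1,1,-1; 1,-1,-1,1],
    !![1,0,0,0; 0,0,1,0; 0,1,0,0; 0,0,0,1],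
    !![1,0,0,0; 0,1,0,0; 0,0,0,1; 0,0,1,0],
    diagonal ![1,1,1,-1]]

theorem gen_transpose (i : Fin 4) : (gen i)ᵀ = gen i := by
  fin_cases i <;> ext a b <;> fin_cases a <;> fin_cases b <;> simp [gen]

theorem gen_mul_self (i : Fin 4) : gen i * gen i = 1 := by
  fin_cases i <;> ext a b <;> fin_cases a <;> fin_cases b <;>
    simp [gen, mul_apply, Fin.sum_univ_four] <;> norm_num

/-- The simple reflections as elements of the general linear group. -/
noncomputable def genUnit (i : Fin 4) : GL (Fin 4) ℝ :=
  ⟨gen i, gen i, gen_mul_self i, gen_mul_self i⟩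

/-- The Weyl group of type `F₄`. -/
noncomputable def weylGroup : Subgroup (GL (Fin 4) ℝ) :=
  Subgroup.closure (Set.range genUnit)

/-- Half of an integer vector, as a real vector. -/
noncomputable def half (v : Fin 4 → ℤ) : Fin 4 → ℝ := fun i => (v i : ℝ) / 2

theorem half_vecMul_gen {v : Fin 4 → ℤ} (hv : v ∈ shortRoots) (i : Fin 4) :
    half v ᵥ* gen i = half (reflect i v) := by
  have h := ediv_dotProduct_self_mul v hv i
  unfold reflect
  generalize 2 * (v ⬝ᵥ simpleRoot i) / (simpleRoot i ⬝ᵥ simpleRoot i) = c at h ⊢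
  have h' := congrArg (Int.cast (R := ℝ)) h
  fin_cases i <;> ext j <;> fin_cases j <;>
    simp [half, gen, simpleRoot, vecMul, dotProduct, Fin.sum_univ_four] at h' ⊢ <;> linarith

theorem single_vecMul_gen {i j : Fin 4} (h : j < i) :
    Pi.single j 1 ᵥ* gen i = Pi.single j 1 := by
  rw [single_one_vecMul]
  ext b
  fin_cases i <;> fin_cases j <;> first
    | exact absurd h (by decide)
    | fin_cases b <;> simp [gen]

theorem exists_vecMul_eq_foldl_ascend (k : Fin 4) (l : List (Fin 4)) (hl : ∀ i ∈ l, k ≤ i)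
    {v : Fin 4 → ℤ} (hv : v ∈ shortRoots) :
    ∃ g ∈ weylGroup, (∀ j < k, Pi.single j 1 ᵥ* g.val = Pi.single j 1) ∧
      half v ᵥ* g.val = half (l.foldl ascend v) := by
  induction l generalizing v with
  | nil => exact ⟨1, one_mem _, by simp, by simp⟩
  | cons i l ih =>
    rw [List.forall_mem_cons] at hl
    rw [List.foldl_cons]
    by_cases hi : v ⬝ᵥ simpleRoot i < 0
    · rw [show ascend v i = reflect i v from if_pos hi]
      obtain ⟨g, hg, hfix, hvg⟩ := ih hl.2 (reflect_mem v hv i)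
      refine ⟨genUnit i * g, mul_mem (Subgroup.subset_closure ⟨i, rfl⟩) hg, fun j hj => ?_, ?_⟩
      · rw [Units.val_mul, ← vecMul_vecMul, show (genUnit i).val = gen i from rfl,
          single_vecMul_gen (hj.trans_le hl.1), hfix j hj]
      · rw [Units.val_mul, ← vecMul_vecMul, show (genUnit i).val = gen i from rfl,
          half_vecMul_gen hv, hvg]
    · rw [show ascend v i = v from if_neg hi]
      exact ih hl.2 hv

/-- Half of an integer matrix, as a real matrix. -/
noncomputable def halfMatrix (M : Matrix (Fin 4) (Fin 4) ℤ) : Matrix (Fin 4) (Fin 4) ℝ :=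
  of fun i => half (M i)

theorem halfMatrix_injective : Function.Injective halfMatrix := by
  intro M N h
  ext i j
  have := congrFun (congrFun h i) j
  simpa [halfMatrix, half] using this

theorem halfMatrix_mul_transpose {M : Matrix (Fin 4) (Fin 4) ℤ} :
    halfMatrix M * (halfMatrix M)ᵀ = 1 ↔ M ∈ frames := by
  rw [mem_frames, ← Matrix.ext_iff, ← Matrix.ext_iff]
  refine forall₂_congr fun i j => ?_
  rw [show (4 : Matrix (Fin 4) (Fin 4) ℤ) = diagonal (fun _ => 4) from rfl, diagonal_apply,
    one_apply, ← Int.cast_inj (α := ℝ)]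
  simp only [mul_apply, Fin.sum_univ_four, transpose_apply, halfMatrix, half, of_apply]
  split_ifs <;> push_cast <;> constructor <;> intro h <;> linarith

theorem row_mem_shortRoots {M : Matrix (Fin 4) (Fin 4) ℤ} (hM : M ∈ frames) (i : Fin 4) :
    M i ∈ shortRoots := by
  rw [mem_shortRoots]
  have := congrFun (congrFun (mem_frames.mp hM) i) i
  rwa [mul_apply', show (4 : Matrix (Fin 4) (Fin 4) ℤ) = diagonal (fun _ => 4) from rfl,
    diagonal_apply_eq] at this

theorem exists_frame_mul_gen {M : Matrix (Fin 4) (Fin 4) ℤ} (hM : M ∈ frames) (i : Fin 4) :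
    ∃ N ∈ frames, halfMatrix M * gen i = halfMatrix N := by
  have h : halfMatrix M * gen i = halfMatrix (of fun a => reflect i (M a)) := by
    funext a
    exact half_vecMul_gen (row_mem_shortRoots hM a) i
  refine ⟨_, ?_, h⟩
  rw [← halfMatrix_mul_transpose, ← h, transpose_mul, gen_transpose, Matrix.mul_assoc,
    ← Matrix.mul_assoc (gen i), gen_mul_self, Matrix.one_mul, halfMatrix_mul_transpose]
  exact hM

theorem exists_frame_mul {g : GL (Fin 4) ℝ} (hg : g ∈ weylGroup)
    {M : Matrix (Fin 4) (Fin 4) ℤ} (hM : M ∈ frames) :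
    ∃ N ∈ frames, halfMatrix M * g.val = halfMatrix N := by
  induction hg using Subgroup.closure_induction_right with
  | one => exact ⟨M, hM, by simp⟩
  | mul_right x _ y hy ih =>
    obtain ⟨i, rfl⟩ := hy
    obtain ⟨N, hN, h⟩ := ih
    rw [Units.val_mul, ← Matrix.mul_assoc, h]
    exact exists_frame_mul_gen hN i
  | mul_inv_cancel x _ y hy ih =>
    obtain ⟨i, rfl⟩ := hy
    obtain ⟨N, hN, h⟩ := ih
    rw [Units.val_mul, ← Matrix.mul_assoc, h]
    exact exists_frame_mul_gen hN i

theorem exists_mul_rows_eq_single {M : Matrix (Fin 4) (Fin 4) ℤ} (hM : M ∈ frames) (k : ℕ)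
    (hk : k ≤ 4) :
    ∃ g ∈ weylGroup, ∀ j : Fin 4, j.val < k → (halfMatrix M * g.val) j = Pi.single j 1 := by
  induction k with
  | zero => exact ⟨1, one_mem _, by simp⟩
  | succ k ih =>
    obtain ⟨g, hg, hrows⟩ := ih (by lia)
    obtain ⟨N, hN, h⟩ := exists_frame_mul hg hM
    rw [h] at hrows
    have hzero : ∀ j < (⟨k, hk⟩ : Fin 4), N ⟨k, hk⟩ j = 0 := by
      intro j hj
      have horth := congrFun (congrFun (halfMatrix_mul_transpose.mpr hN) ⟨k, hk⟩) j
      rw [mul_apply', one_apply_ne hj.ne', show (fun l => (halfMatrix N)ᵀ l j) = Pi.single j 1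
        from hrows j hj, dotProduct_single] at horth
      simpa [halfMatrix, half] using horth
    obtain ⟨g', hg', hfix, hvec⟩ := exists_vecMul_eq_foldl_ascend ⟨k, hk⟩ (longWord ⟨k, hk⟩)
      (by simp [longWord]) (row_mem_shortRoots hN ⟨k, hk⟩)
    rw [foldl_ascend_longWord _ _ (row_mem_shortRoots hN _) hzero] at hvec
    refine ⟨g * g', mul_mem hg hg', fun j hj => ?_⟩
    rw [Units.val_mul, ← Matrix.mul_assoc, h]
    change halfMatrix N j ᵥ* g'.val = _
    rcases Nat.lt_succ_iff_lt_or_eq.mp hj with hj | hj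
    · rw [hrows j hj, hfix j hj]
    · obtain rfl : j = ⟨k, hk⟩ := Fin.ext hj
      refine hvec.trans ?_
      ext l
      simp only [half, Pi.single_apply]
      split_ifs <;> simp

theorem image_val_weylGroup :
    Units.val '' (weylGroup : Set (GL (Fin 4) ℝ)) = halfMatrix '' frames := by
  ext A
  constructor
  · rintro ⟨g, hg, rfl⟩
    have hone : halfMatrix (diagonal fun _ => 2) = 1 := by
      ext i j
      by_cases hij : i = j <;> simp [halfMatrix, half, one_apply, hij]
    have hmem : (diagonal fun _ => 2) ∈ frames := by
      rw [← halfMatrix_mul_transpose, hone]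
      simp
    obtain ⟨N, hN, h⟩ := exists_frame_mul hg hmem
    rw [hone, Matrix.one_mul] at h
    exact ⟨N, hN, h.symm⟩
  · rintro ⟨M, hM, rfl⟩
    obtain ⟨g, hg, hrows⟩ := exists_mul_rows_eq_single hM 4 le_rfl
    have h : halfMatrix M * g.val = 1 := by
      ext i j
      rw [hrows i i.isLt, one_apply, Pi.single_apply]
      simp only [eq_comm]
    exact ⟨g⁻¹, inv_mem hg, Units.inv_eq_of_mul_eq_one_left h⟩

theorem card_weylGroup : Nat.card weylGroup = 1152 := by
  rw [← SetLike.coe_sort_coe, Nat.card_coe_set_eq,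
    ← Set.ncard_image_of_injective _ Units.val_injective, image_val_weylGroup,
    Set.ncard_image_of_injective _ halfMatrix_injective, Set.ncard_coe_finset, card_frames]

end WeylF4

theorem stmt_3 :
    let e₁ : Matrix (Fin 4) (Fin 4) ℝ :=
      (1/2 : ℝ) • !![1,1,1,1; 1,1,-1,-1; 1,-1,1,-1; 1,-1,-1,1]
    let e₂ : Matrix (Fin 4) (Fin 4) ℝ := Matrix.diagonal ![1,1,1,-1]
    let e₃ : Matrix (Fin 4) (Fin 4) ℝ := !![1,0,0,0; 0,1,0,0; 0,0,0,1; 0,0,1,0]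
    let e₄ : Matrix (Fin 4) (Fin 4) ℝ := !![1,0,0,0; 0,0,1,0; 0,1,0,0; 0,0,0,1]
    ∃ g₁ g₂ g₃ g₄ : GL (Fin 4) ℝ,
      (g₁ : Matrix (Fin 4) (Fin 4) ℝ) = e₁ ∧ (g₂ : Matrix (Fin 4) (Fin 4) ℝ) = e₂ ∧
      (g₃ : Matrix (Fin 4) (Fin 4) ℝ) = e₃ ∧ (g₄ : Matrix (Fin 4) (Fin 4) ℝ) = e₄ ∧
      Nat.card (Subgroup.closure {g₁, g₂, g₃, g₄} : Subgroup (GL (Fin 4) ℝ)) = 1152 := by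
  refine ⟨WeylF4.genUnit 0, WeylF4.genUnit 3, WeylF4.genUnit 2, WeylF4.genUnit 1,
    rfl, rfl, rfl, rfl, ?_⟩
  have hrange : ({WeylF4.genUnit 0, WeylF4.genUnit 3, WeylF4.genUnit 2, WeylF4.genUnit 1} :
      Set (GL (Fin 4) ℝ)) = Set.range WeylF4.genUnit := by
    ext g
    simp only [Set.mem_insert_iff, Set.mem_singleton_iff, Set.mem_range, Fin.exists_fin_succ,
      Fin.exists_fin_zero]
    simp only [eq_comm (a := g)]
    tauto
  rw [hrange]
  exact WeylF4.card_weylGroup
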